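/- Let E be a complete separable metric space with metric d and p ≥ 1. For any n ∈ ℕ, weights α ∈ (0,1]^n with Σᵢ αᵢ = 1, and ν in the p-th Wasserstein space P_p(E), the set of n-tuples (ν₁, …, ν_n) ∈ P_p(E)^n satisfying Σᵢ αᵢ νᵢ = ν is compact in the product topology of the Wasserstein metric. -/

import Mathlib

open MeasureTheory ENNReal

/-- The `p`-th Wasserstein distance: the infimum over couplings of
`(∫ d(x,y)^p dθ)^(1/p)`. -/
noncomputable def wassersteinP {E : Type*} [MetricSpace E] [MeasurableSpace E]
    (p : ℝ) (μ ν : Measure E) : ℝ≥0∞ :=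
  (⨅ θ ∈ {θ : Measure (E × E) |
      IsProbabilityMeasure θ ∧ θ.map Prod.fst = μ ∧ θ.map Prod.snd = ν},
    ∫⁻ z, edist z.1 z.2 ^ p ∂θ) ^ (1 / p)

/-- Membership in the `p`-th Wasserstein space `P_p(E)`: a Borel probability measure
with a finite `p`-th moment. -/
def memWassersteinSpace {E : Type*} [MetricSpace E] [MeasurableSpace E]
    (p : ℝ) (μ : Measure E) : Prop :=
  IsProbabilityMeasure μ ∧ ∃ x₀ : E, ∫⁻ x, edist x x₀ ^ p ∂μ ≠ ∞

open Filter Topology ProbabilityTheory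

lemma W_le_of_coupling {E : Type*} [MetricSpace E] [MeasurableSpace E]
    (p : ℝ) (hp : 1 ≤ p) (μ ν : Measure E) (θ : Measure (E × E)) (h : IsProbabilityMeasure θ)
    (h1 : θ.map Prod.fst = μ) (h2 : θ.map Prod.snd = ν) :
    wassersteinP p μ ν ≤ (∫⁻ z, edist z.1 z.2 ^ p ∂θ) ^ (1 / p) := by
  unfold wassersteinP
  apply ENNReal.rpow_le_rpow _ (by positivity)
  exact iInf₂_le θ ⟨h, h1, h2⟩

lemma exists_coupling {E : Type*} [MetricSpace E] [MeasurableSpace E]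
    (p : ℝ) (hp : 1 ≤ p) (μ ν : Measure E) (r : ℝ≥0∞) (h : wassersteinP p μ ν < r) :
    ∃ θ : Measure (E × E), IsProbabilityMeasure θ ∧ θ.map Prod.fst = μ ∧ θ.map Prod.snd = ν ∧
      (∫⁻ z, edist z.1 z.2 ^ p ∂θ) ^ (1 / p) < r := by
  have hp0 : 0 < p := by linarith
  unfold wassersteinP at h
  rw [one_div] at h ⊢
  have h' := (ENNReal.rpow_inv_lt_iff hp0).1 h
  simp only [iInf_lt_iff] at h'
  obtain ⟨θ, ⟨h0, h1, h2⟩, h3⟩ := h'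
  exact ⟨θ, h0, h1, h2, (ENNReal.rpow_inv_lt_iff hp0).2 h3⟩

lemma W_triangle {E : Type*} [MetricSpace E] [CompleteSpace E]
    [TopologicalSpace.SeparableSpace E] [MeasurableSpace E] [BorelSpace E]
    (p : ℝ) (hp : 1 ≤ p) (μ ν ρ : Measure E) :
    wassersteinP p μ ρ ≤ wassersteinP p μ ν + wassersteinP p ν ρ := by
  have : SecondCountableTopology E := UniformSpace.secondCountable_of_separable E
  by_cases hA : wassersteinP p μ ν = ∞
  · simp [hA]
  by_cases hB : wassersteinP p ν ρ = ∞
  · simp [hB]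
  apply ENNReal.le_of_forall_pos_le_add
  intro ε hε _
  have hε' : (0 : ℝ≥0∞) < ε / 2 := ENNReal.half_pos (by simpa using hε.ne')
  obtain ⟨θ, hθ, t1, t2, t3⟩ := exists_coupling p hp μ ν _ (ENNReal.lt_add_right hA hε'.ne')
  obtain ⟨γ, hγ, g1, g2, g3⟩ := exists_coupling p hp ν ρ _ (ENNReal.lt_add_right hB hε'.ne')
  have : Nonempty E := by
    obtain ⟨z⟩ := nonempty_of_isProbabilityMeasure θ
    exact ⟨z.1⟩
  let Θ : Measure ((E × E) × E) := θ ⊗ₘ (γ.condKernel.comap Prod.snd measurable_snd)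
  have hΘ1 : Θ.map Prod.fst = θ := Measure.fst_compProd _ _
  have hΘ2 : Θ.map (fun w => (w.1.2, w.2)) = γ := by
    have h0 : γ = γ.fst ⊗ₘ γ.condKernel := (γ.disintegrate γ.condKernel).symm
    have h1 : γ.fst = θ.map Prod.snd := by rw [t2]; exact g1
    have hm : Measurable (fun w : (E × E) × E => (w.1.2, w.2)) := by fun_prop
    ext s hs
    conv_rhs => rw [h0, h1]
    rw [Measure.compProd_apply hs, Measure.map_apply hm hs, Measure.compProd_apply (hm hs),
      lintegral_map (Kernel.measurable_kernel_prodMk_left hs) measurable_snd]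
    rfl
  have hΘp : IsProbabilityMeasure Θ := by infer_instance
  let π : Measure (E × E) := Θ.map (fun w => (w.1.1, w.2))
  have hm : Measurable (fun w : (E × E) × E => (w.1.1, w.2)) := by fun_prop
  have hm2 : Measurable (fun w : (E × E) × E => (w.1.2, w.2)) := by fun_prop
  have hπ : IsProbabilityMeasure π := Measure.isProbabilityMeasure_map hm.aemeasurable
  have hc : Measurable (fun z : E × E => edist z.1 z.2 ^ p) := by fun_prop
  refine (W_le_of_coupling p hp μ ρ π hπ ?_ ?_).trans ?_
  · rw [Measure.map_map measurable_fst hm, ← t1, ← hΘ1, Measure.map_map measurable_fst measurable_fst]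
    rfl
  · rw [Measure.map_map measurable_snd hm, ← g2, ← hΘ2, Measure.map_map measurable_snd hm2]
    rfl
  · rw [lintegral_map hc hm]
    have e1 : ∫⁻ z, edist z.1 z.2 ^ p ∂θ = ∫⁻ w, edist w.1.1 w.1.2 ^ p ∂Θ := by
      rw [← hΘ1, lintegral_map hc measurable_fst]
    have e2 : ∫⁻ z, edist z.1 z.2 ^ p ∂γ = ∫⁻ w, edist w.1.2 w.2 ^ p ∂Θ := by
      rw [← hΘ2, lintegral_map hc hm2]
    rw [e1] at t3
    rw [e2] at g3
    calc (∫⁻ w, edist w.1.1 w.2 ^ p ∂Θ) ^ (1 / p)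
        ≤ (∫⁻ w, ((fun w : (E × E) × E => edist w.1.1 w.1.2) +
            (fun w : (E × E) × E => edist w.1.2 w.2)) w ^ p ∂Θ) ^ (1 / p) := by
          gcongr with w
          exact edist_triangle _ _ _
      _ ≤ _ := ENNReal.lintegral_Lp_add_le (by fun_prop) (by fun_prop) hp
      _ ≤ (wassersteinP p μ ν + ε / 2) + (wassersteinP p ν ρ + ε / 2) := add_le_add t3.le g3.le
      _ = wassersteinP p μ ν + wassersteinP p ν ρ + (ε / 2 + ε / 2) := by ring
      _ = _ := by rw [ENNReal.add_halves]

lemma W_map_le {E : Type*} [MetricSpace E] 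
    [TopologicalSpace.SeparableSpace E] [MeasurableSpace E] [BorelSpace E]
    (p : ℝ) (hp : 1 ≤ p) (μ : Measure E) [IsProbabilityMeasure μ] (T : E → E) (hT : Measurable T) :
    wassersteinP p μ (μ.map T) ≤ (∫⁻ x, edist x (T x) ^ p ∂μ) ^ (1 / p) ∧
    wassersteinP p (μ.map T) μ ≤ (∫⁻ x, edist x (T x) ^ p ∂μ) ^ (1 / p) := by
  have : SecondCountableTopology E := UniformSpace.secondCountable_of_separable E
  have hc : Measurable (fun z : E × E => edist z.1 z.2 ^ p) := by fun_prop
  have h1 : Measurable (fun x => (x, T x)) := by fun_prop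
  have h2 : Measurable (fun x => (T x, x)) := by fun_prop
  constructor
  · refine (W_le_of_coupling p hp _ _ (μ.map (fun x => (x, T x)))
      (Measure.isProbabilityMeasure_map h1.aemeasurable) ?_ ?_).trans ?_
    · rw [Measure.map_map measurable_fst h1]; exact Measure.map_id
    · rw [Measure.map_map measurable_snd h1]; rfl
    · rw [lintegral_map hc h1]
  · refine (W_le_of_coupling p hp _ _ (μ.map (fun x => (T x, x)))
      (Measure.isProbabilityMeasure_map h2.aemeasurable) ?_ ?_).trans ?_
    · rw [Measure.map_map measurable_fst h2]; rfl
    · rw [Measure.map_map measurable_snd h2]; exact Measure.map_id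
    · rw [lintegral_map hc h2]
      simp_rw [edist_comm]
      exact le_rfl

lemma W_discrete {E : Type*} [MetricSpace E]
    [TopologicalSpace.SeparableSpace E] [MeasurableSpace E] [BorelSpace E]
    (p : ℝ) (hp : 1 ≤ p) (s : Finset E) (a b : E → ℝ≥0∞) (ha : ∑ c ∈ s, a c = 1)
    (hb : ∑ c ∈ s, b c = 1) :
    wassersteinP p (∑ c ∈ s, a c • Measure.dirac c) (∑ c ∈ s, b c • Measure.dirac c) ≤
      ((∑ c ∈ s, ∑ d ∈ s, edist c d ^ p) * ∑ c ∈ s, (a c - b c)) ^ (1 / p) := by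
  have : SecondCountableTopology E := UniformSpace.secondCountable_of_separable E
  set t := ∑ c ∈ s, (a c - b c) with ht
  have hmin : ∀ a b : ℝ≥0∞, min a b + (a - b) = a := fun a b => by
    rcases le_total a b with h | h
    · simp [h, tsub_eq_zero_of_le h]
    · simp [h, add_tsub_cancel_of_le]
  have hA : ∑ c ∈ s, min (a c) (b c) + t = 1 := by
    rw [ht, ← Finset.sum_add_distrib, ← ha]
    exact Finset.sum_congr rfl fun c _ => hmin _ _
  have hB : ∑ c ∈ s, min (a c) (b c) + ∑ c ∈ s, (b c - a c) = 1 := by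
    rw [← Finset.sum_add_distrib, ← hb]
    exact Finset.sum_congr rfl fun c _ => by rw [min_comm]; exact hmin _ _
  have hfin : ∑ c ∈ s, min (a c) (b c) ≠ ∞ := fun h => by simp [h] at hA
  have ht' : ∑ c ∈ s, (b c - a c) = t := by
    rw [← hA] at hB
    exact (ENNReal.add_right_inj hfin).1 hB
  have htop : t ≠ ∞ := fun h => by simp [h] at hA
  have htt : ∀ x, (t = 0 → x = 0) → t⁻¹ * x * t = x := by
    intro x hx
    by_cases h : t = 0
    · simp [hx h]
    · rw [mul_right_comm, ENNReal.inv_mul_cancel h htop, one_mul]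
  let θ : Measure (E × E) := ∑ c ∈ s, min (a c) (b c) • Measure.dirac (c, c) +
    ∑ c ∈ s, ∑ d ∈ s, (t⁻¹ * (a c - b c) * (b d - a d)) • Measure.dirac (c, d)
  have h1 : θ.map Prod.fst = ∑ c ∈ s, a c • Measure.dirac c := by
    ext u hu
    rw [Measure.map_apply measurable_fst hu]
    simp only [θ, Measure.add_apply, Measure.finsetSum_apply, Measure.smul_apply, smul_eq_mul,
      Measure.dirac_apply]
    have : ∀ c d : E, (Prod.fst ⁻¹' u).indicator (1 : E × E → ℝ≥0∞) (c, d) = u.indicator 1 c := 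
      fun c d => rfl
    simp only [this]
    rw [← Finset.sum_add_distrib]
    refine Finset.sum_congr rfl fun c hc => ?_
    rw [← Finset.sum_mul, ← Finset.mul_sum, ht', htt, ← add_mul, hmin]
    intro h
    exact Finset.sum_eq_zero_iff.1 h c hc
  have h2 : θ.map Prod.snd = ∑ c ∈ s, b c • Measure.dirac c := by
    ext u hu
    rw [Measure.map_apply measurable_snd hu]
    simp only [θ, Measure.add_apply, Measure.finsetSum_apply, Measure.smul_apply, smul_eq_mul,
      Measure.dirac_apply]
    have : ∀ c d : E, (Prod.snd ⁻¹' u).indicator (1 : E × E → ℝ≥0∞) (c, d) = u.indicator 1 d := 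
      fun c d => rfl
    simp only [this]
    rw [Finset.sum_comm (s := s) (t := s), ← Finset.sum_add_distrib]
    refine Finset.sum_congr rfl fun c hc => ?_
    simp_rw [mul_right_comm _ _ (b c - a c)]
    rw [← Finset.sum_mul, ← Finset.mul_sum, ← ht, htt, ← add_mul, min_comm, hmin]
    intro h
    rw [← ht'] at h
    exact Finset.sum_eq_zero_iff.1 h c hc
  have hθ : IsProbabilityMeasure θ := by
    constructor
    have : θ Set.univ = (θ.map Prod.fst) Set.univ := by
      rw [Measure.map_apply measurable_fst MeasurableSet.univ]; rfl
    rw [this, h1]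
    simpa using ha
  refine (W_le_of_coupling p hp _ _ θ hθ h1 h2).trans ?_
  apply ENNReal.rpow_le_rpow _ (by positivity)
  simp only [θ, lintegral_add_measure, lintegral_finsetSum_measure, lintegral_smul_measure,
    lintegral_dirac, edist_self, ENNReal.zero_rpow_of_pos (show 0 < p by linarith), smul_eq_mul,
    mul_zero, Finset.sum_const_zero, zero_add]
  rw [Finset.sum_mul]
  refine Finset.sum_le_sum fun c hc => ?_
  rw [Finset.sum_mul]
  refine Finset.sum_le_sum fun d hd => ?_
  rw [mul_comm]
  gcongr
  have e1 : a c - b c ≤ t := Finset.single_le_sum (f := fun c => a c - b c) (by simp) hc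
  have e2 : b d - a d ≤ t := by
    rw [← ht']; exact Finset.single_le_sum (f := fun c => b c - a c) (by simp) hd
  calc t⁻¹ * (a c - b c) * (b d - a d) ≤ t⁻¹ * t * t := by gcongr
    _ = t := htt t id

lemma map_simple {E : Type*} [MetricSpace E] [MeasurableSpace E] [BorelSpace E]
    (T : SimpleFunc E E) (μ : Measure E) :
    μ.map T = ∑ c ∈ T.range, μ (T ⁻¹' {c}) • Measure.dirac c := by
  classical
  ext u hu
  rw [Measure.map_apply T.measurable hu]
  simp only [Measure.finsetSum_apply, Measure.smul_apply, smul_eq_mul, Measure.dirac_apply' _ hu]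
  have : T ⁻¹' u = T ⁻¹' ((T.range.filter (· ∈ u) : Finset E) : Set E) := by
    ext x; simp
  rw [this, ← SimpleFunc.sum_measure_preimage_singleton, Finset.sum_filter]
  refine Finset.sum_congr rfl fun c _ => ?_
  simp [Set.indicator_apply]

lemma exists_simple {E : Type*} [MetricSpace E]
    [TopologicalSpace.SeparableSpace E] [MeasurableSpace E] [BorelSpace E]
    (p : ℝ) (hp : 1 ≤ p) (ν : Measure E) (x₀ : E) (h : ∫⁻ x, edist x x₀ ^ p ∂ν ≠ ∞) :
    ∃ T : ℕ → SimpleFunc E E,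
      Tendsto (fun k => ∫⁻ x, edist x (T k x) ^ p ∂ν) atTop (𝓝 0) := by
  have : SecondCountableTopology E := UniformSpace.secondCountable_of_separable E
  have hp0 : 0 < p := by linarith
  refine ⟨fun k => SimpleFunc.approxOn id measurable_id Set.univ x₀ (Set.mem_univ _) k, ?_⟩
  have := tendsto_lintegral_of_dominated_convergence (μ := ν) (F := fun k x => 
    edist x (SimpleFunc.approxOn id measurable_id Set.univ x₀ (Set.mem_univ _) k x) ^ p)
    (f := fun _ => 0) (fun x => edist x x₀ ^ p) ?_ ?_ h ?_
  · simpa using this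
  · intro k
    have := (SimpleFunc.approxOn id measurable_id Set.univ x₀ (Set.mem_univ x₀) k).measurable
    fun_prop
  · intro k
    refine Eventually.of_forall fun x => ?_
    refine ENNReal.rpow_le_rpow ?_ hp0.le
    rw [edist_comm, edist_comm x]
    exact SimpleFunc.edist_approxOn_le measurable_id (Set.mem_univ x₀) x k
  · refine Eventually.of_forall fun x => ?_
    have h1 := SimpleFunc.tendsto_approxOn (measurable_id (α := E)) (Set.mem_univ x₀)
      (x := x) (by simp)
    have h2 := (tendsto_iff_edist_tendsto_0.1 h1).ennrpow_const p
    rw [ENNReal.zero_rpow_of_pos hp0] at h2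
    simpa [edist_comm] using h2

/-- A finitely additive set function dominated by a finite measure is a measure. -/
lemma exists_measure {E : Type*} [MeasurableSpace E] (ν : Measure E) [IsFiniteMeasure ν]
    (C : ℝ≥0∞) (hC : C ≠ ∞) (m : Set E → ℝ≥0∞)
    (hadd : ∀ A B, MeasurableSet A → MeasurableSet B → Disjoint A B → m (A ∪ B) = m A + m B)
    (hle : ∀ A, MeasurableSet A → m A ≤ C * ν A) :
    ∃ μ : Measure E, ∀ A, MeasurableSet A → μ A = m A := by
  have h0 : m ∅ = 0 := by simpa using hle ∅ MeasurableSet.empty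
  refine ⟨Measure.ofMeasurable (fun s _ => m s) h0 ?_, fun A hA => 
    Measure.ofMeasurable_apply A hA⟩
  intro A hA hd
  have key : ∀ N, m (⋃ k, A k) = ∑ k ∈ Finset.range N, m (A k) + m (⋃ k, A (k + N)) := by
    intro N
    induction N with
    | zero => simp
    | succ N ih =>
      rw [ih, Finset.sum_range_succ, add_assoc, ← hadd _ _ (hA N) (MeasurableSet.iUnion fun k => hA _)]
      · congr 2
        ext x
        simp only [Set.mem_iUnion, Set.mem_union]
        constructor
        · rintro ⟨k, hk⟩
          cases k with
          | zero => left; simpa using hk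
          | succ k => right; exact ⟨k, by rwa [show k + (N + 1) = k + 1 + N by ring]⟩
        · rintro (h | ⟨k, hk⟩)
          · exact ⟨0, by simpa using h⟩
          · exact ⟨k + 1, by rwa [show k + 1 + N = k + (N + 1) by ring]⟩
      · rw [Set.disjoint_iUnion_right]
        intro k
        exact hd (by omega)
  have htail : Tendsto (fun N => m (⋃ k, A (k + N))) atTop (𝓝 0) := by
    have h1 : Tendsto (fun N => C * ∑' k, ν (A (k + N))) atTop (𝓝 (C * 0)) := by
      refine ENNReal.Tendsto.const_mul (ENNReal.tendsto_sum_nat_add (fun k => ν (A k)) ?_) (Or.inr hC)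
      rw [← measure_iUnion hd hA]
      exact measure_ne_top _ _
    rw [mul_zero] at h1
    refine tendsto_of_tendsto_of_tendsto_of_le_of_le tendsto_const_nhds h1 (fun _ => zero_le) ?_
    intro N
    refine (hle _ (MeasurableSet.iUnion fun k => hA _)).trans ?_
    exact mul_le_mul_right (measure_iUnion_le _) _
  have h2 := (ENNReal.tendsto_nat_tsum (fun k => m (A k))).add htail
  rw [add_zero] at h2
  refine tendsto_nhds_unique (tendsto_const_nhds.congr fun N => key N) h2

lemma W_tendsto {E : Type*} [MetricSpace E] [CompleteSpace E]
    [TopologicalSpace.SeparableSpace E] [MeasurableSpace E] [BorelSpace E]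
    (p : ℝ) (hp : 1 ≤ p) (ν : Measure E) (x₀ : E) (h : ∫⁻ x, edist x x₀ ^ p ∂ν ≠ ∞)
    (C : ℝ≥0∞) (hC : C ≠ ∞) {ι : Type*} (f : Filter ι) (g : ι → Measure E) (g0 : Measure E)
    (hp0 : IsProbabilityMeasure g0) (hg0 : g0 ≤ C • ν)
    (hg : ∀ᶠ i in f, IsProbabilityMeasure (g i) ∧ g i ≤ C • ν)
    (hlim : ∀ A, MeasurableSet A → Tendsto (fun i => g i A) f (𝓝 (g0 A))) :
    Tendsto (fun i => wassersteinP p g0 (g i)) f (𝓝 0) := by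
  have hpp : 0 < 1 / p := by positivity
  have hpos : 0 ≤ p := by linarith
  rw [ENNReal.tendsto_nhds_zero]
  intro ε hε
  have hε3 : 0 < ε / 3 := ENNReal.div_pos hε.ne' (by simp)
  obtain ⟨T, hT⟩ := exists_simple p hp ν x₀ h
  have hT2 := (ENNReal.Tendsto.const_mul hT (Or.inr hC)).ennrpow_const (1 / p)
  rw [mul_zero, ENNReal.zero_rpow_of_pos hpp] at hT2
  obtain ⟨k, hk⟩ := (ENNReal.tendsto_nhds_zero.1 hT2 _ hε3).exists
  have hdom : ∀ μ : Measure E, μ ≤ C • ν →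
      (∫⁻ x, edist x (T k x) ^ p ∂μ) ^ (1 / p) ≤ ε / 3 := by
    intro μ hμ
    refine le_trans (ENNReal.rpow_le_rpow ?_ hpp.le) hk
    refine (lintegral_mono' hμ le_rfl).trans ?_
    rw [lintegral_smul_measure, smul_eq_mul]
  have hmid : Tendsto (fun i => ((∑ c ∈ (T k).range, ∑ d ∈ (T k).range, edist c d ^ p) *
      ∑ c ∈ (T k).range, (g0 (T k ⁻¹' {c}) - g i (T k ⁻¹' {c}))) ^ (1 / p)) f (𝓝 0) := by
    have h1 : Tendsto (fun i => ∑ c ∈ (T k).range, (g0 (T k ⁻¹' {c}) - g i (T k ⁻¹' {c}))) f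
        (𝓝 (∑ c ∈ (T k).range, (g0 (T k ⁻¹' {c}) - g0 (T k ⁻¹' {c})))) := by
      refine tendsto_finset_sum _ fun c _ => ?_
      exact ENNReal.Tendsto.sub tendsto_const_nhds (hlim _ ((T k).measurableSet_fiber c))
        (Or.inl (measure_ne_top _ _))
    simp only [tsub_self, Finset.sum_const_zero] at h1
    have hD : (∑ c ∈ (T k).range, ∑ d ∈ (T k).range, edist c d ^ p) ≠ ∞ := by
      refine ENNReal.sum_ne_top.2 fun c _ => ENNReal.sum_ne_top.2 fun d _ => ?_
      exact ENNReal.rpow_ne_top_of_nonneg hpos (edist_ne_top _ _)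
    have h2 := (ENNReal.Tendsto.const_mul h1 (Or.inr hD)).ennrpow_const (1 / p)
    rwa [mul_zero, ENNReal.zero_rpow_of_pos hpp] at h2
  filter_upwards [hg, ENNReal.tendsto_nhds_zero.1 hmid _ hε3] with i hi hi2
  obtain ⟨hi0, hi1⟩ := hi
  have htot : ∀ μ : Measure E, IsProbabilityMeasure μ →
      ∑ c ∈ (T k).range, μ (T k ⁻¹' {c}) = 1 := by
    intro μ hμ
    rw [SimpleFunc.sum_range_measure_preimage_singleton]
    exact measure_univ
  calc wassersteinP p g0 (g i)
      ≤ wassersteinP p g0 (g0.map (T k)) + wassersteinP p (g0.map (T k)) (g i) :=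
        W_triangle p hp _ _ _
    _ ≤ wassersteinP p g0 (g0.map (T k)) + (wassersteinP p (g0.map (T k)) ((g i).map (T k)) +
        wassersteinP p ((g i).map (T k)) (g i)) := by
        gcongr
        exact W_triangle p hp _ _ _
    _ ≤ ε / 3 + (ε / 3 + ε / 3) := by
        gcongr
        · exact (W_map_le p hp g0 (T k) (T k).measurable).1.trans (hdom _ hg0)
        · rw [map_simple, map_simple]
          exact (W_discrete p hp _ _ _ (htot _ hp0) (htot _ hi0)).trans hi2
        · exact (W_map_le p hp (g i) (T k) (T k).measurable).2.trans (hdom _ hi1)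
    _ = ε := by rw [← add_assoc, ENNReal.add_thirds]

/-- For a complete separable metric space `E`, `p ≥ 1`, weights `α ∈ (0,1]^n` summing
to one and `ν ∈ P_p(E)`, the set of `n`-tuples `(ν₁, …, ν_n)` in `P_p(E)^n` with
`Σᵢ αᵢ νᵢ = ν` is compact in the product topology of the Wasserstein metric. -/
theorem stmt5 {E : Type*} [MetricSpace E] [CompleteSpace E]
    [TopologicalSpace.SeparableSpace E] [MeasurableSpace E] [BorelSpace E]
    (p : ℝ) (hp : 1 ≤ p) (n : ℕ) (hn : 0 < n)
    (α : Fin n → ℝ) (hα : ∀ i, α i ∈ Set.Ioc (0:ℝ) 1) (hsum : ∑ i, α i = 1)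
    (ν : Measure E) (hν : memWassersteinSpace p ν) :
    @IsCompact (Fin n → Measure E)
      (@Pi.topologicalSpace (Fin n) (fun _ => Measure E) (fun _ =>
        TopologicalSpace.generateFrom
          {B : Set (Measure E) | ∃ ρ r, B = {σ | wassersteinP p ρ σ < r}}))
      {g : Fin n → Measure E |
        (∀ i, memWassersteinSpace p (g i)) ∧
        ∑ i, ENNReal.ofReal (α i) • g i = ν} := by
  obtain ⟨hνp, x₀, hx₀⟩ := hν
  have hα0 : ∀ i, ENNReal.ofReal (α i) ≠ 0 := fun i => by
    simpa using (hα i).1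
  have hαC : ∀ i, (ENNReal.ofReal (α i))⁻¹ ≠ ∞ := fun i => by simpa using (hα i).1
  -- setwise domination from the sum condition
  have dom : ∀ g : Fin n → Measure E, ∑ i, ENNReal.ofReal (α i) • g i = ν →
      ∀ i, g i ≤ (ENNReal.ofReal (α i))⁻¹ • ν := by
    intro g hg i
    rw [Measure.le_iff]
    intro A hA
    rw [← hg]
    simp only [Measure.smul_apply, Measure.finsetSum_apply, smul_eq_mul]
    calc g i A = (ENNReal.ofReal (α i))⁻¹ * (ENNReal.ofReal (α i) * g i A) := by
          rw [← mul_assoc, ENNReal.inv_mul_cancel (hα0 i) ENNReal.ofReal_ne_top, one_mul]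
      _ ≤ _ := mul_le_mul_right (Finset.single_le_sum
          (f := fun j => ENNReal.ofReal (α j) * g j A) (by simp) (Finset.mem_univ i)) _
  refine (@isCompact_iff_ultrafilter_le_nhds _ (_) _).2 ?_
  intro F hF
  have hF' : ∀ᶠ g in (F : Filter (Fin n → Measure E)), (∀ i, memWassersteinSpace p (g i)) ∧
        ∑ i, ENNReal.ofReal (α i) • g i = ν := le_principal_iff.1 hF
  -- setwise limits exist along the ultrafilter
  have hlim : ∀ (i : Fin n) (A : Set E), ∃ y : ℝ≥0∞,
      Tendsto (fun g : Fin n → Measure E => g i A) F (𝓝 y) := by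
    intro i A
    obtain ⟨y, -, hy⟩ := isCompact_iff_ultrafilter_le_nhds.1 (isCompact_univ (X := ℝ≥0∞))
      (F.map (fun g : Fin n → Measure E => g i A)) (by simp)
    exact ⟨y, hy⟩
  choose m hm using hlim
  have hmsum : ∀ A, MeasurableSet A → ∑ i, ENNReal.ofReal (α i) * m i A = ν A := by
    intro A hA
    have h1 : Tendsto (fun g : Fin n → Measure E => ∑ i, ENNReal.ofReal (α i) * g i A) F
        (𝓝 (∑ i, ENNReal.ofReal (α i) * m i A)) :=
      tendsto_finset_sum _ fun i _ =>
        ENNReal.Tendsto.const_mul (hm i A) (Or.inr ENNReal.ofReal_ne_top)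
    refine tendsto_nhds_unique h1 (tendsto_const_nhds.congr' ?_)
    filter_upwards [hF'] with g hg
    rw [← hg.2]
    simp
  have hex : ∀ i, ∃ μ : Measure E, ∀ A, MeasurableSet A → μ A = m i A := by
    intro i
    refine exists_measure ν (ENNReal.ofReal (α i))⁻¹ (hαC i) (m i) ?_ ?_
    · intro A B hA hB hd
      refine tendsto_nhds_unique (hm i (A ∪ B)) (((hm i A).add (hm i B)).congr fun g => ?_)
      exact (measure_union hd hB).symm
    · intro A hA
      refine le_of_tendsto (hm i A) ?_
      filter_upwards [hF'] with g hg
      exact (dom g hg.2 i) A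
  choose g0 hg0 using hex
  have hg0sum : ∑ i, ENNReal.ofReal (α i) • g0 i = ν := by
    ext A hA
    simp only [Measure.smul_apply, Measure.finsetSum_apply, smul_eq_mul]
    rw [← hmsum A hA]
    exact Finset.sum_congr rfl fun i _ => by rw [hg0 i A hA]
  have hg0p : ∀ i, IsProbabilityMeasure (g0 i) := by
    intro i
    constructor
    rw [hg0 i _ MeasurableSet.univ]
    refine tendsto_nhds_unique (hm i Set.univ) (tendsto_const_nhds.congr' ?_)
    filter_upwards [hF'] with g hg
    have := (hg.1 i).1
    exact measure_univ.symm
  refine ⟨g0, ⟨fun i => ⟨hg0p i, x₀, ?_⟩, hg0sum⟩, ?_⟩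
  · refine ne_top_of_le_ne_top ?_ (lintegral_mono' (dom g0 hg0sum i) le_rfl)
    rw [lintegral_smul_measure, smul_eq_mul]
    exact ENNReal.mul_ne_top (hαC i) hx₀
  · letI : TopologicalSpace (Measure E) := TopologicalSpace.generateFrom
          {B : Set (Measure E) | ∃ ρ r, B = {σ | wassersteinP p ρ σ < r}}
    change Tendsto (fun g => g) (F : Filter (Fin n → Measure E)) (𝓝 g0)
    rw [tendsto_pi_nhds]
    intro i
    rw [TopologicalSpace.tendsto_nhds_generateFrom_iff]
    rintro _ ⟨ρ, r, rfl⟩ hmem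
    have hW := W_tendsto p hp ν x₀ hx₀ _ (hαC i) (F : Filter (Fin n → Measure E))
      (fun g => g i) (g0 i) (hg0p i) (dom g0 hg0sum i)
      (by filter_upwards [hF'] with g hg using ⟨(hg.1 i).1, dom g hg.2 i⟩)
      (fun A hA => by rw [hg0 i A hA]; exact hm i A)
    have hW2 := hW.const_add (wassersteinP p ρ (g0 i))
    rw [add_zero] at hW2
    have hlt : wassersteinP p ρ (g0 i) < r := hmem
    filter_upwards [hW2.eventually_lt_const hlt] with g hg
    exact (W_triangle p hp _ _ _).trans_lt hg
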